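/- Let N be a stable 3-pair network with m_{1,2}^1 = {3}, m_{1,2}^2 = {1}, m_{1,3}^1 = {3}, m_{1,3}^3 = {2}, m_{2,3}^2 = {1}, and m_{2,3}^3 = {2}. Then every s ∈ S_N with α(s) = 3 contains a diagonal element; equivalently, no arc of N is simultaneously traversed by three paths P_{s_{l_1},t_1}, P_{s_{l_2},t_2}, P_{s_{l_3},t_3} with l_1 ≠ 1, l_2 ≠ 2 and l_3 ≠ 3. -/

import Mathlib

open scoped BigOperators

/-- A `k`-pair network: a finite DAG with `k` sources of in-degree 0 and
`k` sinks of out-degree 0. -/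
structure KPairNetwork (k : ℕ) where
  V : Type
  A : Type
  [fintypeV : Fintype V]
  [fintypeA : Fintype A]
  [decEqV : DecidableEq V]
  [decEqA : DecidableEq A]
  tail : A → V
  head : A → V
  /-- acyclicity, via a topological ordering of the vertices -/
  acyclic : ∃ ord : V → ℕ, ∀ a : A, ord (tail a) < ord (head a)
  src : Fin k → V
  snk : Fin k → V
  src_inj : Function.Injective src
  snk_inj : Function.Injective snk
  src_no_in : ∀ (i : Fin k) (a : A), head a ≠ src i
  snk_no_out : ∀ (i : Fin k) (a : A), tail a ≠ snk i

attribute [instance] KPairNetwork.fintypeV KPairNetwork.fintypeA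
attribute [instance] KPairNetwork.decEqV KPairNetwork.decEqA

namespace KPairNetwork

variable {k : ℕ} (N : KPairNetwork k)

/-- `l` is (the list of arcs of) a directed path from `u` to `v`. -/
def IsPathFrom (u v : N.V) (l : List N.A) : Prop :=
  l ≠ [] ∧ l.Chain' (fun a b => N.head a = N.tail b) ∧
    (∀ a ∈ l.head?, N.tail a = u) ∧ (∀ a ∈ l.getLast?, N.head a = v)

/-- The vertices lying on a (nonempty) list of arcs. -/
def pathVerts (l : List N.A) : Set N.V :=
  {v | ∃ a ∈ l, v = N.tail a ∨ v = N.head a}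

/-- `P i j` is a path from `s i` to `t j`, and for each sink `j` the `k`
paths `P · j` are pairwise arc-disjoint (strong reachability). -/
def IsStrongSystem (P : Fin k → Fin k → List N.A) : Prop :=
  (∀ i j, N.IsPathFrom (N.src i) (N.snk j) (P i j)) ∧
    ∀ (j i i' : Fin k), i ≠ i' → ∀ a : N.A, a ∈ P i j → a ∉ P i' j

/-- Extra strong reachability: in addition, for each sink `j`, two distinct
paths towards `t j` share no vertex other than `t j`. -/
def IsExtraStrongSystem (P : Fin k → Fin k → List N.A) : Prop :=
  N.IsStrongSystem P ∧
    ∀ (j i i' : Fin k), i ≠ i' →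
      ∀ v : N.V, v ∈ N.pathVerts (P i j) → v ∈ N.pathVerts (P i' j) → v = N.snk j

/-- Stability: the choice of the `k` pairwise arc-disjoint paths towards each
sink is unique. -/
def IsStableSystem (P : Fin k → Fin k → List N.A) : Prop :=
  N.IsStrongSystem P ∧
    ∀ (j : Fin k) (Q : Fin k → List N.A),
      (∀ i, N.IsPathFrom (N.src i) (N.snk j) (Q i)) →
      (∀ i i', i ≠ i' → ∀ a : N.A, a ∈ Q i → a ∉ Q i') →
      ∀ i, Q i = P i j

/-- `excess_f(v) = Σ_{head a = v} f a − Σ_{tail a = v} f a`. -/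
noncomputable def excess (f : N.A → ℝ) (v : N.V) : ℝ :=
  (∑ a : N.A, if N.head a = v then f a else 0) -
    (∑ a : N.A, if N.tail a = v then f a else 0)

/-- An `u`–`v` flow: zero excess away from `u` and `v`. -/
def IsFlow (u v : N.V) (f : N.A → ℝ) : Prop :=
  ∀ w : N.V, w ≠ u → w ≠ v → N.excess f w = 0

/-- The unit flow along a path: `1` on its arcs and `0` elsewhere. -/
noncomputable def unitFlow (l : List N.A) : N.A → ℝ :=
  fun a => if a ∈ l then 1 else 0

/-- The set of source/sink index pairs whose path passes through the arc `a`. -/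
def arcPattern (P : Fin k → Fin k → List N.A) (a : N.A) : Finset (Fin k × Fin k) :=
  Finset.univ.filter (fun q => a ∈ P q.1 q.2)

/-- `S_N`, the family of index-pair patterns of the arcs of `N`. -/
def SN (P : Fin k → Fin k → List N.A) : Set (Finset (Fin k × Fin k)) :=
  {T | ∃ a : N.A, T = N.arcPattern P a}

/-! ### Segments and longest common segments -/

/-- A segment: a start vertex together with a (possibly empty) chained list of
arcs starting there.  A segment with no arcs is a single vertex. -/
def IsSeg (s : N.V × List N.A) : Prop :=
  s.2.Chain' (fun a b => N.head a = N.tail b) ∧ ∀ a ∈ s.2.head?, N.tail a = s.1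

/-- The vertices of a segment. -/
def segVerts (s : N.V × List N.A) : Set N.V :=
  insert s.1 (N.pathVerts s.2)

/-- The final vertex of a segment. -/
def segEnd (s : N.V × List N.A) : N.V :=
  s.2.getLast?.elim s.1 N.head

/-- The segment `s` lies on the path `p`. -/
def SegOn (s : N.V × List N.A) (p : List N.A) : Prop :=
  s.2 <:+: p ∧ s.1 ∈ N.pathVerts p

/-- The segment `s` is contained in the segment `s'`. -/
def SegLE (s s' : N.V × List N.A) : Prop :=
  s.2 <:+: s'.2 ∧ s.1 ∈ N.segVerts s'

/-- `s` is a longest common segment (l.c.s.) of the set of paths `ps`: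
it is a segment common to all paths of `ps`, and no segment properly
containing it is common to all paths of `ps`. -/
def IsLCS (ps : Set (List N.A)) (s : N.V × List N.A) : Prop :=
  N.IsSeg s ∧ (∀ p ∈ ps, N.SegOn s p) ∧
    ∀ s' : N.V × List N.A, N.IsSeg s' → N.SegLE s s' → s' ≠ s →
      ∃ p ∈ ps, ¬ N.SegOn s' p

/-- `s` is an l.c.s. of some pair `{P i j₁, P i' j₂}` and lies on `p`. -/
def IsPairLCSOn (P : Fin k → Fin k → List N.A) (j₁ j₂ : Fin k)
    (p : List N.A) (s : N.V × List N.A) : Prop :=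
  (∃ i i' : Fin k, N.IsLCS {P i j₁, P i' j₂} s) ∧ N.SegOn s p

/-- `ℓ^{j₁,j₂}(p)`: the number of l.c.s.'s of pairs `{P i j₁, P i' j₂}` lying
on the path `p`. -/
noncomputable def lcsCount (P : Fin k → Fin k → List N.A) (j₁ j₂ : Fin k)
    (p : List N.A) : ℕ :=
  Nat.card {s : N.V × List N.A | N.IsPairLCSOn P j₁ j₂ p s}

/-- `m_{j₁,j₂}^c = {i : ℓ^{j₁,j₂}(P_{s_i,t_c}) = 1}`. -/
def mset (P : Fin k → Fin k → List N.A) (j₁ j₂ c : Fin k) : Set (Fin k) :=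
  {i | N.lcsCount P j₁ j₂ (P i c) = 1}

/-- `u` lies strictly before `v` along the path `p` (there is a nonempty
infix of `p` going from `u` to `v`). -/
def StrictlyBeforeOn (p : List N.A) (u v : N.V) : Prop :=
  ∃ l : List N.A, l <:+: p ∧ l.head?.map N.tail = some u ∧ l.getLast?.map N.head = some v

/-- `e 0, …, e (L-1)` enumerates, in the order along `p`, the l.c.s.'s
`p(1) < p(2) < ⋯ < p(L)` of pairs `{P i j₁, P i' j₂}` lying on `p`. -/
def IsLCSEnum (P : Fin k → Fin k → List N.A) (j₁ j₂ : Fin k) (p : List N.A)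
    (e : ℕ → N.V × List N.A) (L : ℕ) : Prop :=
  (∀ n, n < L → N.IsPairLCSOn P j₁ j₂ p (e n)) ∧
  (∀ s, N.IsPairLCSOn P j₁ j₂ p s → ∃ n, n < L ∧ e n = s) ∧
  (∀ m n, m < n → n < L → N.StrictlyBeforeOn p (N.segEnd (e m)) (e n).1)

/-! ### Residual networks, regular cycles, semi-cycles and crossings -/

/-- `a` is a `P_{t_j}`-arc. -/
def isPArc (P : Fin k → Fin k → List N.A) (j : Fin k) (a : N.A) : Prop :=
  ∃ i, a ∈ P i j

/-- The tail of `a` in the `j`-th residual network `N_j` (in which all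
`P_{t_j}`-arcs are reversed). -/
def rtail (P : Fin k → Fin k → List N.A) (j : Fin k) (a : N.A) : N.V :=
  if ∃ i, a ∈ P i j then N.head a else N.tail a

/-- The head of `a` in the `j`-th residual network `N_j`. -/
def rhead (P : Fin k → Fin k → List N.A) (j : Fin k) (a : N.A) : N.V :=
  if ∃ i, a ∈ P i j then N.tail a else N.head a

/-- `l` is a directed cycle of the residual network `N_j`. -/
def IsResidCycle (P : Fin k → Fin k → List N.A) (j : Fin k) (l : List N.A) : Prop :=
  l ≠ [] ∧ l.Nodup ∧
  l.Chain' (fun a b => N.rhead P j a = N.rtail P j b) ∧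
  (∀ a ∈ l.getLast?, ∀ b ∈ l.head?, N.rhead P j a = N.rtail P j b) ∧
  (l.map (N.rtail P j)).Nodup

/-- A regular cycle of `N_j`: a directed cycle of `N_j` having no isolated
vertex of `P_{t_j}`, i.e. every vertex of the cycle lying on a path of
`P_{t_j}` is incident in the cycle to some (reversed) `P_{t_j}`-arc. -/
def IsRegularCycle (P : Fin k → Fin k → List N.A) (j : Fin k) (l : List N.A) : Prop :=
  N.IsResidCycle P j l ∧
    ∀ v ∈ l.map (N.rtail P j),
      (∃ i, v ∈ N.pathVerts (P i j)) →
      ∃ a ∈ l, N.isPArc P j a ∧ (v = N.tail a ∨ v = N.head a)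

/-- A `P_{t_j}`-semi-cycle of `N`: the arc set of a regular cycle of `N_j`,
with the original orientations of `N` restored. -/
def IsSemiCycle (P : Fin k → Fin k → List N.A) (j : Fin k) (E : Set N.A) : Prop :=
  ∃ l : List N.A, N.IsRegularCycle P j l ∧ E = {a | a ∈ l}

/-- A `P_{t_j}`-crossing of `N`: a `P_{t_j}`-semi-cycle with all its
`P_{t_j}`-arcs removed. -/
def IsCrossing (P : Fin k → Fin k → List N.A) (j : Fin k) (E : Set N.A) : Prop :=
  ∃ l : List N.A, N.IsRegularCycle P j l ∧ E = {a | a ∈ l ∧ ¬ N.isPArc P j a}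

end KPairNetwork

/-- `l` lists the arcs of a walk from `u` to `v`, where the arc `a` goes from `f a` to `g a`. -/
def IsWalk {V A : Type*} (f g : A → V) : V → V → List A → Prop
  | u, v, [] => u = v
  | u, v, a :: l => f a = u ∧ IsWalk f g (g a) v l

namespace IsWalk

variable {V A : Type*} {f g : A → V} {u v w : V} {l m : List A}

theorem append_iff : IsWalk f g u w (l ++ m) ↔ ∃ v, IsWalk f g u v l ∧ IsWalk f g v w m := by
  induction l generalizing u with
  | nil => simp [IsWalk]
  | cons a l ih => simp [IsWalk, ih, and_assoc]

theorem iff_isChain (hl : l ≠ []) : IsWalk f g u v l ↔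
    l.IsChain (fun a b => g a = f b) ∧ (∀ a ∈ l.head?, f a = u) ∧ ∀ a ∈ l.getLast?, g a = v := by
  induction l generalizing u with
  | nil => exact absurd rfl hl
  | cons a l ih =>
    cases l with
    | nil => simp [IsWalk]
    | cons b l =>
      rw [IsWalk, ih (by simp)]
      simp only [List.isChain_cons_cons, List.head?_cons, Option.mem_some_iff, forall_eq',
        List.getLast?_cons_cons]
      constructor
      · rintro ⟨h₁, h₂, h₃, h₄⟩
        exact ⟨⟨h₃.symm, h₂⟩, h₁, h₄⟩
      · rintro ⟨⟨h₃, h₂⟩, h₁, h₄⟩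
        exact ⟨h₁, h₂, h₃.symm, h₄⟩

theorem sum_sub (h : IsWalk f g u v l) (φ : V → ℤ) :
    (l.map fun a => φ (f a) - φ (g a)).sum = φ u - φ v := by
  induction l generalizing u with
  | nil => simp [show u = v from h]
  | cons a l ih => simp [ih h.2, h.1]

theorem exists_nodup (h : IsWalk f g u u l) (hl : l ≠ []) :
    ∃ v m, IsWalk f g v v m ∧ m ≠ [] ∧ m.Nodup := by
  induction hn : l.length using Nat.strong_induction_on generalizing u l with
  | _ n ih =>
    by_cases hd : l.Nodup
    · exact ⟨u, l, h, hl, hd⟩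
    · obtain ⟨a, ha⟩ : ∃ a, [a, a].Sublist l := by
        simpa [List.nodup_iff_sublist] using hd
      obtain ⟨l₁, l₂, rfl, h₁, h₂⟩ := List.cons_sublist_iff.1 ha
      obtain ⟨s, t, rfl⟩ := List.append_of_mem h₁
      obtain ⟨s', t', rfl⟩ := List.append_of_mem (List.singleton_sublist.1 h₂)
      have hcut : s ++ a :: t ++ (s' ++ a :: t') = s ++ ((a :: (t ++ s')) ++ a :: t') := by simp
      rw [hcut, append_iff] at h
      obtain ⟨x, -, h⟩ := h
      obtain ⟨y, hy, hy'⟩ := append_iff.1 h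
      obtain rfl : x = y := hy.1.symm.trans hy'.1
      exact ih _ (by simp [← hn]; omega) hy (by simp) rfl

theorem exists_of_transGen (h : Relation.TransGen (fun x y => ∃ a, f a = x ∧ g a = y) u v) :
    ∃ l, l ≠ [] ∧ IsWalk f g u v l := by
  induction h with
  | single h =>
    obtain ⟨a, rfl, rfl⟩ := h
    exact ⟨[a], by simp, rfl, rfl⟩
  | tail _ h ih =>
    obtain ⟨a, rfl, rfl⟩ := h
    obtain ⟨l, -, hl⟩ := ih
    exact ⟨l ++ [a], by simp, append_iff.2 ⟨_, hl, rfl, rfl⟩⟩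

end IsWalk

section Flow

variable {V A : Type*} [DecidableEq V] [DecidableEq A] (f g : A → V)

/-- The out-degree minus the in-degree of the vertex `v` in the arc set `F`. -/
def netOut (F : Finset A) (v : V) : ℤ :=
  ∑ a ∈ F, ((if f a = v then 1 else 0) - if g a = v then 1 else 0)

variable {f g}

theorem netOut_sdiff_walk {F : Finset A} {u t : V} {l : List A} (hw : IsWalk f g u t l)
    (hd : l.Nodup) (hl : ∀ a ∈ l, a ∈ F) (v : V) :
    netOut f g (F \ l.toFinset) v =
      netOut f g F v - ((if u = v then 1 else 0) - if t = v then 1 else 0) := by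
  rw [← hw.sum_sub (fun x => if x = v then 1 else 0), ← List.sum_toFinset _ hd, netOut, netOut,
    ← Finset.sum_sdiff (s₁ := l.toFinset) (s₂ := F) fun a ha => hl a (List.mem_toFinset.1 ha)]
  ring

theorem exists_walk_of_netOut {t : V} {c : V → ℤ} (hc : ∀ v, 0 ≤ c v) {u : V} {F : Finset A}
    (h : ∀ v, v ≠ t → netOut f g F v = c v + if u = v then 1 else 0) :
    ∃ l, IsWalk f g u t l ∧ l.Nodup ∧ ∀ a ∈ l, a ∈ F := by
  induction F using Finset.strongInduction generalizing u with
  | H F ih =>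
    by_cases hut : u = t
    · exact ⟨[], hut, by simp, by simp⟩
    · have hpos : 0 < netOut f g F u := by
        rw [h u hut, if_pos rfl]
        linarith [hc u]
      obtain ⟨a, ha, rfl⟩ : ∃ a ∈ F, f a = u := by
        by_contra! hn
        refine hpos.not_ge (Finset.sum_nonpos fun a ha => ?_)
        rw [if_neg (hn a ha)]
        split_ifs <;> simp
      obtain ⟨l, hl, hd, hlF⟩ := ih (F.erase a) (Finset.erase_ssubset ha) (u := g a) fun v hv => by
        have h₁ := h v hv
        rw [netOut, ← Finset.add_sum_erase _ _ ha] at h₁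
        rw [netOut]
        linarith
      refine ⟨a :: l, ⟨rfl, hl⟩, List.nodup_cons.2 ⟨fun hal => ?_, hd⟩, ?_⟩
      · simpa using hlF a hal
      · rintro b (_ | ⟨_, hb⟩)
        · exact ha
        · exact Finset.mem_of_mem_erase (hlF b hb)

/-- An arc set carrying one unit of flow from each `s i` to `t` contains pairwise disjoint walks
from the `s i` to `t`. -/
theorem exists_disjoint_walks {ι : Type*} [DecidableEq ι] {t : V} (s : ι → V) (S : Finset ι)
    {F : Finset A}
    (h : ∀ v, v ≠ t → netOut f g F v = ∑ i ∈ S, if s i = v then 1 else 0) :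
    ∃ Q : ι → List A, (∀ i ∈ S, IsWalk f g (s i) t (Q i)) ∧ (∀ i ∈ S, ∀ a ∈ Q i, a ∈ F) ∧
      ∀ i ∈ S, ∀ j ∈ S, i ≠ j → ∀ a ∈ Q i, a ∉ Q j := by
  induction S using Finset.induction_on generalizing F with
  | empty => exact ⟨fun _ => [], by simp, by simp, by simp⟩
  | insert i S hi ih =>
    obtain ⟨l, hl, hd, hlF⟩ := exists_walk_of_netOut (f := f) (g := g) (F := F) (t := t) (u := s i)
      (c := fun v => ∑ i ∈ S, if s i = v then 1 else 0)
      (fun v => Finset.sum_nonneg fun _ _ => by split_ifs <;> simp)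
      fun v hv => by rw [h v hv, Finset.sum_insert hi, add_comm]
    obtain ⟨Q, hQ, hQF, hQd⟩ := ih (F := F \ l.toFinset) fun v hv => by
      rw [netOut_sdiff_walk hl hd hlF, h v hv, Finset.sum_insert hi, if_neg hv.symm]
      ring
    have hne : ∀ j ∈ S, j ≠ i := fun j hj hji => hi (hji ▸ hj)
    have hQl : ∀ j ∈ S, ∀ a ∈ Q j, a ∉ l := fun j hj a ha => by
      simpa using (Finset.mem_sdiff.1 (hQF j hj a ha)).2
    refine ⟨Function.update Q i l, fun j hj => ?_, fun j hj a ha => ?_,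
      fun j hj k hk hjk a ha ha' => ?_⟩
    · rcases Finset.mem_insert.1 hj with rfl | hj
      · simpa using hl
      · simpa [hne j hj] using hQ j hj
    · rcases Finset.mem_insert.1 hj with rfl | hj
      · exact hlF a (by simpa using ha)
      · exact (Finset.mem_sdiff.1 (hQF j hj a (by simpa [hne j hj] using ha))).1
    · rcases Finset.mem_insert.1 hj with rfl | hj' <;> rcases Finset.mem_insert.1 hk with rfl | hk'
      · exact hjk rfl
      · exact hQl k hk' a (by simpa [hne k hk'] using ha') (by simpa using ha)
      · exact hQl j hj' a (by simpa [hne j hj'] using ha) (by simpa using ha')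
      · exact hQd j hj' k hk' hjk a (by simpa [hne j hj'] using ha) (by simpa [hne k hk'] using ha')

theorem netOut_symmDiff (F L : Finset A) (v : V) :
    netOut f g (symmDiff F L) v = netOut f g F v +
      ∑ a ∈ L, ((if (if a ∈ F then g a else f a) = v then 1 else 0) -
        if (if a ∈ F then f a else g a) = v then 1 else 0) := by
  have key : ∀ φ : A → ℤ, ∑ a ∈ symmDiff F L, φ a =
      ∑ a ∈ F, φ a + ∑ a ∈ L, if a ∈ F then - φ a else φ a := by
    intro φ
    rw [symmDiff_def, Finset.sup_eq_union, Finset.sum_union disjoint_sdiff_sdiff,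
      Finset.sum_ite, Finset.filter_mem_eq_inter, Finset.filter_notMem_eq_sdiff,
      Finset.sum_neg_distrib, Finset.inter_comm, ← Finset.sum_inter_add_sum_sdiff F L]
    ring
  rw [netOut, key, netOut]
  congr 1
  refine Finset.sum_congr rfl fun a _ => ?_
  by_cases h : a ∈ F <;> simp [h]

end Flow

/-- The vertex sets of three pairwise disjoint paths towards each of three sinks, together with
the reachability relations of the three residual networks. -/
structure ResidualConfig (V : Type*) where
  ord : V → ℕ
  W : Fin 3 → Fin 3 → Set V
  /-- `R j u v`: there is a nonempty directed walk from `u` to `v` in the `j`-th residual network -/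
  R : Fin 3 → V → V → Prop
  trans : ∀ {j u v w}, R j u v → R j v w → R j u w
  irrefl : ∀ {j u}, ¬ R j u u
  inj : ∀ {i j u v}, u ∈ W i j → v ∈ W i j → ord u = ord v → u = v
  rev : ∀ {i j u v}, u ∈ W i j → v ∈ W i j → ord u < ord v → R j v u
  disj : ∀ {i i' j n j' v}, j' ≠ j → v ∈ W n j' → v ∈ W i j → v ∈ W i' j → i = i'
  step : ∀ {n j j' u w}, u ∈ W n j' → w ∈ W n j' → ord u < ord w →
    (∀ x ∈ W n j', ord u < ord x → ord x < ord w → ∀ i, x ∉ W i j) →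
    (∀ i, u ∈ W i j → w ∉ W i j) → R j u w
  agree : ∀ {n i j j' u w}, j' ≠ j → u ∈ W n j' → u ∈ W i j → w ∈ W n j' → w ∈ W i j →
    (∀ x ∈ W n j', ord u < ord x → ord x < ord w → ∀ m, x ∈ W m j → m = i) →
    ∀ x, ord u ≤ ord x → ord x ≤ ord w → (x ∈ W n j' ↔ x ∈ W i j)
  start : Fin 3 → V
  start_mem : ∀ i j, start i ∈ W i j
  start_le : ∀ {i j v}, v ∈ W i j → ord (start i) ≤ ord v
  /-- the paths `W (j + 2) j` meet the paths towards the other sinks only in an initial segment -/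
  initial : ∀ {i j j' v}, j' ≠ j → v ∈ W (j + 2) j → v ∈ W i j' →
    i = j + 2 ∧ ∀ u ∈ W (j + 2) j', ord u ≤ ord v → u ∈ W (j + 2) j
  meet : ∀ j, ∃ v, v ∈ W (j + 1) (j + 1) ∧ v ∈ W j j

namespace ResidualConfig

variable {V : Type*} (C : ResidualConfig V)

/-- Starting from `u`, the path `W n j'` follows `W i j` up to `v`, where it leaves
`W i j`; the next vertex `w` at which it meets paths towards the sink `j` is on `W i' j`. -/
structure IsJump (n j' i i' j : Fin 3) (u v w : V) : Prop where
  mem_v : v ∈ C.W n j'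
  mem_v' : v ∈ C.W i j
  mem_w : w ∈ C.W n j'
  mem_w' : w ∈ C.W i' j
  le : C.ord u ≤ C.ord v
  lt : C.ord v < C.ord w
  reach : C.R j v w
  agree : ∀ x, C.ord u ≤ C.ord x → C.ord x ≤ C.ord v → (x ∈ C.W n j' ↔ x ∈ C.W i j)
  gap : ∀ x ∈ C.W n j', C.ord v < C.ord x → C.ord x < C.ord w → ∀ m, x ∉ C.W m j

variable {C}

theorem eq_or_third {j i i' : Fin 3} (hii : i ≠ i') (hi : i ≠ j + 2) (hi' : i' ≠ j + 2)
    (m : Fin 3) : m = i ∨ m = i' ∨ m = j + 2 := by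
  revert j i i' m; decide

theorem exists_isJump [Finite V] {j j' n i i' : Fin 3} {u a : V} (hj : j' ≠ j) (hii : i ≠ i')
    (hi : i ≠ j + 2) (hi' : i' ≠ j + 2) (hu : u ∈ C.W n j') (hui : u ∈ C.W i j)
    (ha : a ∈ C.W n j') (hai : a ∈ C.W i' j) (hua : C.ord u < C.ord a) :
    ∃ v w, C.IsJump n j' i i' j u v w ∧ C.ord w ≤ C.ord a := by
  have third : ∀ x ∈ C.W n j', C.ord u < C.ord x → x ∉ C.W (j + 2) j := by
    intro x hx hux hxz
    obtain ⟨rfl, h⟩ := C.initial hj hxz hx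
    exact hi (C.disj hj hu hui (h u hu hux.le))
  obtain ⟨w, ⟨hw, hwi, huw⟩, hwmin⟩ := Set.exists_min_image
    {x | x ∈ C.W n j' ∧ x ∈ C.W i' j ∧ C.ord u < C.ord x} C.ord (Set.toFinite _) ⟨a, ha, hai, hua⟩
  obtain ⟨v, ⟨hv, hvi, hvw, huv⟩, hvmax⟩ := Set.exists_max_image
    {x | x ∈ C.W n j' ∧ x ∈ C.W i j ∧ C.ord x < C.ord w ∧ C.ord u ≤ C.ord x} C.ord
    (Set.toFinite _) ⟨u, hu, hui, huw, le_rfl⟩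
  have gap : ∀ x ∈ C.W n j', C.ord v < C.ord x → C.ord x < C.ord w → ∀ m, x ∉ C.W m j := by
    intro x hx hvx hxw m hm
    rcases eq_or_third hii hi hi' m with rfl | rfl | rfl
    · exact absurd (hvmax x ⟨hx, hm, hxw, by omega⟩) (by omega)
    · exact absurd (hwmin x ⟨hx, hm, by omega⟩) (by omega)
    · exact third x hx (by omega) hm
  refine ⟨v, w, ⟨hv, hvi, hw, hwi, huv, hvw, ?_, ?_, gap⟩, hwmin a ⟨ha, hai, hua⟩⟩
  · refine C.step hv hw hvw gap fun m hm hm' => hii ?_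
    rw [C.disj hj hv hvi hm, C.disj hj hw hwi hm']
  · refine C.agree hj hu hui hv hvi fun x hx hux hxv m hm => ?_
    rcases eq_or_third hii hi hi' m with rfl | rfl | rfl
    · rfl
    · exact absurd (hwmin x ⟨hx, hm, hux⟩) (by omega)
    · exact absurd hm (third x hx hux)

/-- A vertex on a path towards `j` that is weakly after another one reaches everything
the other one reaches. -/
theorem reach_of_le {i j : Fin 3} {u v w : V} (hu : u ∈ C.W i j) (hv : v ∈ C.W i j)
    (h : C.ord u ≤ C.ord v) (hr : C.R j u w) : C.R j v w := by
  rcases h.lt_or_eq with h | h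
  · exact C.trans (C.rev hu hv h) hr
  · rwa [← C.inj hu hv h]

/-- The indices are a cyclic rotation of `(0, 1, 2)`. -/
def IsCyc (j k l : Fin 3) : Prop := k = j + 1 ∧ l = j + 2

theorem IsCyc.rotate {j k l : Fin 3} (h : IsCyc j k l) : IsCyc k l j := by
  obtain ⟨rfl, rfl⟩ := h
  unfold IsCyc
  revert j; decide

theorem IsCyc.ne {j k l : Fin 3} (h : IsCyc j k l) : j ≠ k ∧ k ≠ l ∧ l ≠ j := by
  obtain ⟨rfl, rfl⟩ := h
  revert j; decide

/-- How the paths `W k k` and `W k j` from the source `k` separate, for the cyclically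
consecutive sinks `j` and `k`: they separate at `e`, after which `W k k` proceeds to a vertex `p`
of `W j j` and `W k j` proceeds to a vertex `b` of `W l k`. -/
structure IsSplit (C : ResidualConfig V) (j k l : Fin 3) (e p b : V) : Prop where
  e_mem : e ∈ C.W k k
  e_mem' : e ∈ C.W k j
  p_mem : p ∈ C.W k k
  p_mem' : p ∈ C.W j j
  b_mem : b ∈ C.W k j
  b_mem' : b ∈ C.W l k
  e_lt_p : C.ord e < C.ord p
  e_lt_b : C.ord e < C.ord b
  reach_p : C.R j e p
  reach_b : C.R k e b
  agree : ∀ x, C.ord x ≤ C.ord e → (x ∈ C.W k k ↔ x ∈ C.W k j)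
  gap_p : ∀ x ∈ C.W k k, C.ord e < C.ord x → C.ord x < C.ord p → ∀ m, x ∉ C.W m j
  gap_b : ∀ x ∈ C.W k j, C.ord e < C.ord x → C.ord x < C.ord b → ∀ m, x ∉ C.W m k

theorem exists_isSplit [Finite V] {j k l : Fin 3} (h : IsCyc j k l) {a : V}
    (ha : a ∈ C.W k j) (ha' : a ∈ C.W l k) : ∃ e p b, C.IsSplit j k l e p b := by
  obtain ⟨hjk, hkl, hlj⟩ := h.ne
  have hl := h.2
  have hj : j = k + 2 := h.rotate.2
  obtain ⟨v, hv, hv'⟩ : ∃ v, v ∈ C.W k k ∧ v ∈ C.W j j := h.1 ▸ C.meet j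
  have hsv : C.ord (C.start k) < C.ord v := by
    refine lt_of_le_of_ne (C.start_le hv) fun h => hjk ?_
    rw [← C.inj (C.start_mem k k) hv h] at hv'
    exact C.disj hjk.symm (C.start_mem k k) hv' (C.start_mem k j)
  obtain ⟨e, p, he, -⟩ := C.exists_isJump hjk.symm hjk.symm (hl ▸ hkl) (hl ▸ hlj.symm)
    (C.start_mem k k) (C.start_mem k j) hv hv' hsv
  have agree : ∀ x, C.ord x ≤ C.ord e → (x ∈ C.W k k ↔ x ∈ C.W k j) := fun x hx =>
    ⟨fun h => (he.agree x (C.start_le h) hx).1 h, fun h => (he.agree x (C.start_le h) hx).2 h⟩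
  have hea : C.ord e < C.ord a := by
    by_contra! hae
    exact hkl (C.disj hjk ha ((agree a hae).2 ha) ha')
  obtain ⟨f, b, hf, -⟩ := C.exists_isJump hjk hkl (hj ▸ hjk.symm) (hj ▸ hlj)
    he.mem_v' he.mem_v ha ha' hea
  have hfp : C.ord f < C.ord p := by
    by_contra! hpf
    have := (hf.agree p he.lt.le hpf).2 he.mem_w
    exact hjk (C.disj hjk.symm he.mem_w he.mem_w' this)
  have hfe : C.ord f ≤ C.ord e := by
    by_contra! hef
    exact he.gap f hf.mem_v' hef hfp k hf.mem_v
  obtain rfl : e = f := C.inj he.mem_v' hf.mem_v (le_antisymm hf.le hfe)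
  exact ⟨e, p, b, he.mem_v, he.mem_v', he.mem_w, he.mem_w', hf.mem_w, hf.mem_w', he.lt, hf.lt,
    he.reach, hf.reach, agree, he.gap, hf.gap⟩

namespace IsSplit

variable {j k l : Fin 3} {e p b a e' p' b' e'' p'' b'' : V}

theorem lt_of_mem (h : C.IsSplit j k l e p b) (hc : IsCyc j k l) {x : V} (hx : x ∈ C.W k j)
    (hx' : x ∈ C.W l k) : C.ord e < C.ord x := by
  obtain ⟨hjk, hkl, hlj⟩ := hc.ne
  by_contra! hxe
  exact hkl (C.disj hjk hx ((h.agree x hxe).2 hx) hx')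

theorem le_of_mem (h : C.IsSplit j k l e p b) (hc : IsCyc j k l) {x : V} (hx : x ∈ C.W k j)
    (hx' : x ∈ C.W l k) : C.ord b ≤ C.ord x := by
  by_contra! hxb
  exact h.gap_b x hx (h.lt_of_mem hc hx hx') hxb l hx'

/-- Walking around the three separation points in the residual network `j` closes a cycle unless
one of the two jumps arrives too early. -/
theorem lt_or_lt (h : C.IsSplit j k l e p b) (h' : C.IsSplit l j k e' p' b') :
    (C.ord e' < C.ord b' ∧ C.ord b' < C.ord e) ∨ (C.ord e < C.ord p ∧ C.ord p < C.ord e') := by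
  by_contra! hn
  have h₁ := hn.1 h'.e_lt_b
  have h₂ := hn.2 h.e_lt_p
  exact C.irrefl (C.trans (reach_of_le h'.e_mem h.p_mem' h₂ h'.reach_b)
    (reach_of_le h.e_mem' h'.b_mem' h₁ h.reach_p))

theorem p_lt (h : C.IsSplit j k l e p b) (hc : IsCyc j k l) [Finite V] (ha : a ∈ C.W k j)
    (ha' : a ∈ C.W l k) {c : V} (hcj : c ∈ C.W j j) (hck : c ∈ C.W l k)
    (hca : C.ord c < C.ord a) : C.ord p < C.ord c := by
  obtain ⟨hjk, hkl, hlj⟩ := hc.ne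
  have hl := hc.2
  by_contra! hcp
  obtain ⟨v, w, hv, -⟩ := C.exists_isJump hjk.symm hjk (hl ▸ hlj.symm) (hl ▸ hkl) hck hcj ha' ha hca
  have hvp : C.ord v ≤ C.ord p := by
    by_contra! hpv
    exact hkl (C.disj hjk h.p_mem' h.p_mem ((hv.agree p hcp hpv.le).2 h.p_mem'))
  exact C.irrefl (C.trans (reach_of_le hv.mem_v' h.p_mem' hvp hv.reach)
    (reach_of_le h.e_mem' hv.mem_w' (h.lt_of_mem hc hv.mem_w' hv.mem_w).le h.reach_p))

theorem lt_b (h : C.IsSplit j k l e p b) (hc : IsCyc j k l) [Finite V] (ha : a ∈ C.W k j)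
    (ha' : a ∈ C.W l k) {c : V} (hcj : c ∈ C.W j j) (hck : c ∈ C.W l k)
    (hca : C.ord c < C.ord a) : C.ord c < C.ord b := by
  obtain ⟨hjk, hkl, hlj⟩ := hc.ne
  have hl := hc.2
  have hj : j = k + 2 := hc.rotate.2
  by_contra! hbc
  obtain ⟨q, hq, hq', hbq, hqa⟩ :
      ∃ q, q ∈ C.W k k ∧ q ∈ C.W k j ∧ C.ord b < C.ord q ∧ C.ord q < C.ord a := by
    by_contra! hn
    refine hjk (C.disj hjk.symm hck hcj ((C.agree hjk h.b_mem h.b_mem' ha ha' ?_ c hbc hca.le).2 hck))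
    intro x hx hbx hxa m hm
    rcases eq_or_third (j := k) hkl (hj ▸ hjk.symm) (hj ▸ hlj) m with rfl | rfl | rfl
    · exact absurd hxa (not_lt.2 (hn x hm hx hbx))
    · rfl
    · exact absurd (hj ▸ (C.initial (hj ▸ hjk) hm hx).1) hjk.symm
  have hpq : C.ord p < C.ord q := by
    by_contra! hqp
    rcases hqp.lt_or_eq with hqp | hqp
    · exact h.gap_p q hq (h.e_lt_b.trans hbq) hqp k hq'
    · exact hjk (C.disj hjk.symm hq (C.inj hq h.p_mem hqp ▸ h.p_mem') hq')
  obtain ⟨u, q', hu, -⟩ := C.exists_isJump hjk.symm hjk (hl ▸ hlj.symm) (hl ▸ hkl)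
    h.p_mem h.p_mem' hq hq' hpq
  have hbq' : C.ord b ≤ C.ord q' := by
    by_contra! hqb
    exact h.gap_b q' hu.mem_w' ((h.e_lt_p.trans_le hu.le).trans hu.lt) hqb k hu.mem_w
  have hbc' : C.ord b < C.ord c := by
    refine lt_of_le_of_ne hbc fun hbc => hjk ?_
    exact C.disj hjk.symm hck hcj (C.inj h.b_mem' hck hbc ▸ h.b_mem)
  obtain ⟨v, c', hv, hcc'⟩ := C.exists_isJump hjk.symm hjk.symm (hl ▸ hkl) (hl ▸ hlj.symm)
    h.b_mem' h.b_mem hck hcj hbc'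
  have hvq : C.ord v ≤ C.ord q' := by
    by_contra! hqv
    exact hkl (C.disj hjk hu.mem_w' hu.mem_w ((hv.agree q' hbq' hqv.le).2 hu.mem_w'))
  have hpc : C.ord p < C.ord c' :=
    h.p_lt hc ha ha' hv.mem_w' hv.mem_w (hcc'.trans_lt hca)
  have huc : C.ord u ≤ C.ord c' := by
    by_contra! hcu
    exact hkl (C.disj hjk hv.mem_w' ((hu.agree c' hpc.le hcu.le).2 hv.mem_w') hv.mem_w)
  exact C.irrefl (C.trans (reach_of_le hu.mem_v' hv.mem_w' huc hu.reach)
    (reach_of_le hv.mem_v' hu.mem_w' hvq hv.reach))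

theorem false_of_le [Finite V] (h : C.IsSplit j k l e p b) (h' : C.IsSplit k l j e' p' b')
    (h'' : C.IsSplit l j k e'' p'' b'') (hc : IsCyc j k l) (ha : a ∈ C.W k j)
    (ha' : a ∈ C.W l k) (ha'' : a ∈ C.W j l) (hee : C.ord e ≤ C.ord e'')
    (hee' : C.ord e' ≤ C.ord e'') : False := by
  obtain ⟨hjk, hkl, hlj⟩ := hc.ne
  have hl := hc.2
  have h₁ := h.lt_or_lt h''
  have h₂ := h''.lt_or_lt h'
  have h₃ := h'.lt_or_lt h
  have hb' : b' ∈ C.W j j := (h''.agree b' (by omega)).2 h'.b_mem'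
  have hba : C.ord b' < C.ord a := by
    refine lt_of_le_of_ne (h'.le_of_mem hc.rotate ha' ha'') fun hba => hjk ?_
    exact C.disj hlj ha'' (C.inj h'.b_mem ha' hba ▸ hb') ha
  have h₄ := h.p_lt hc ha ha' hb' h'.b_mem hba
  have h₅ := h.lt_b hc ha ha' hb' h'.b_mem hba
  have hp' : p' ∈ C.W k j := (h.agree p' (by omega)).1 h'.p_mem'
  have := h''.e_lt_p
  obtain ⟨f, q, hf, -⟩ := C.exists_isJump hlj hjk.symm (hl ▸ hkl) (hl ▸ hlj.symm)
    h'.p_mem hp' h''.p_mem' h''.p_mem (by omega)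
  have hq : C.ord e'' ≤ C.ord q := by
    by_contra! hqe
    exact hlj (C.disj hlj.symm hf.mem_w' hf.mem_w ((h''.agree q hqe.le).1 hf.mem_w'))
  have hfb : C.ord f ≤ C.ord b'' := by
    by_contra! hbf
    have := h''.e_lt_b
    exact hlj (C.disj hlj.symm h''.b_mem' ((hf.agree b'' (by omega) hbf.le).2 h''.b_mem') h''.b_mem)
  exact C.irrefl (C.trans (reach_of_le h''.e_mem hf.mem_w' hq h''.reach_b)
    (reach_of_le hf.mem_v' h''.b_mem' hfb hf.reach))

end IsSplit

/-- No vertex lies on all three of the paths `W (j + 1) j`. -/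
theorem not_mem_all [Finite V] (C : ResidualConfig V) {a : V} (h₀ : a ∈ C.W 1 0)
    (h₁ : a ∈ C.W 2 1) (h₂ : a ∈ C.W 0 2) : False := by
  have c₀ : IsCyc 0 1 2 := ⟨rfl, rfl⟩
  have c₁ : IsCyc 1 2 0 := c₀.rotate
  have c₂ : IsCyc 2 0 1 := c₁.rotate
  obtain ⟨e₀, p₀, b₀, s₀⟩ := exists_isSplit c₀ h₀ h₁
  obtain ⟨e₁, p₁, b₁, s₁⟩ := exists_isSplit c₁ h₁ h₂
  obtain ⟨e₂, p₂, b₂, s₂⟩ := exists_isSplit c₂ h₂ h₀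
  rcases le_total (C.ord e₀) (C.ord e₁) with h₀₁ | h₀₁ <;>
    rcases le_total (C.ord e₁) (C.ord e₂) with h₁₂ | h₁₂ <;>
    rcases le_total (C.ord e₀) (C.ord e₂) with h₀₂ | h₀₂
  all_goals first
    | exact s₀.false_of_le s₁ s₂ c₀ h₀ h₁ h₂ (by omega) (by omega)
    | exact s₁.false_of_le s₂ s₀ c₁ h₁ h₂ h₀ (by omega) (by omega)
    | exact s₂.false_of_le s₀ s₁ c₂ h₂ h₀ h₁ (by omega) (by omega)

end ResidualConfig

namespace KPairNetwork

variable {k : ℕ} {N : KPairNetwork k} {P : Fin k → Fin k → List N.A}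

/-- A topological ordering of the vertices. -/
noncomputable def topOrd (N : KPairNetwork k) : N.V → ℕ := N.acyclic.choose

theorem topOrd_lt (a : N.A) : N.topOrd (N.tail a) < N.topOrd (N.head a) := N.acyclic.choose_spec a

theorem isPathFrom_iff {u v : N.V} {l : List N.A} :
    N.IsPathFrom u v l ↔ l ≠ [] ∧ IsWalk N.tail N.head u v l :=
  and_congr_right fun h => (IsWalk.iff_isChain h).symm

section Walk

variable {u v x y : N.V} {l : List N.A}

theorem tail_mem_pathVerts {a : N.A} (h : a ∈ l) : N.tail a ∈ N.pathVerts l := ⟨a, h, Or.inl rfl⟩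

theorem head_mem_pathVerts {a : N.A} (h : a ∈ l) : N.head a ∈ N.pathVerts l := ⟨a, h, Or.inr rfl⟩

theorem pathVerts_mono {l m : List N.A} (h : l ⊆ m) : N.pathVerts l ⊆ N.pathVerts m :=
  fun _ ⟨a, ha, hx⟩ => ⟨a, h ha, hx⟩

theorem insert_pathVerts_cons {a : N.A} :
    insert (N.tail a) (N.pathVerts (a :: l)) =
      insert (N.tail a) (insert (N.head a) (N.pathVerts l)) := by
  ext x
  simp only [pathVerts, List.mem_cons, Set.mem_insert_iff, Set.mem_ofPred_eq]
  grind

theorem start_mem_pathVerts (h : IsWalk N.tail N.head u v l) (hl : l ≠ []) : u ∈ N.pathVerts l := by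
  cases l with
  | nil => exact absurd rfl hl
  | cons a l => exact h.1 ▸ tail_mem_pathVerts (by simp)

theorem end_mem_insert_pathVerts (h : IsWalk N.tail N.head u v l) :
    v ∈ insert u (N.pathVerts l) := by
  induction l generalizing u with
  | nil => exact Or.inl (Eq.symm h)
  | cons a l ih =>
    obtain ⟨rfl, h⟩ := h
    rw [insert_pathVerts_cons]
    exact Or.inr (ih h)

theorem eq_start_or_lt (h : IsWalk N.tail N.head u v l) (hx : x ∈ insert u (N.pathVerts l)) :
    x = u ∨ N.topOrd u < N.topOrd x := by
  induction l generalizing u with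
  | nil => exact Or.inl (by simpa [pathVerts] using hx)
  | cons a l ih =>
    obtain ⟨rfl, h⟩ := h
    rw [insert_pathVerts_cons] at hx
    have ha := N.topOrd_lt a
    rcases hx with rfl | hx
    · exact Or.inl rfl
    · rcases ih h hx with rfl | hx
      · exact Or.inr ha
      · exact Or.inr (ha.trans hx)

theorem eq_end_or_lt (h : IsWalk N.tail N.head u v l) (hx : x ∈ insert u (N.pathVerts l)) :
    x = v ∨ N.topOrd x < N.topOrd v := by
  induction l generalizing u x with
  | nil =>
    obtain rfl : u = v := h
    exact Or.inl (by simpa [pathVerts] using hx)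
  | cons a l ih =>
    obtain ⟨rfl, h⟩ := h
    rw [insert_pathVerts_cons] at hx
    have ha := N.topOrd_lt a
    rcases hx with rfl | hx
    · right
      rcases ih h (x := N.head a) (Or.inl rfl) with h | h
      · rwa [← h]
      · exact ha.trans h
    · exact ih h hx

theorem start_le (h : IsWalk N.tail N.head u v l) (hx : x ∈ N.pathVerts l) :
    N.topOrd u ≤ N.topOrd x := by
  rcases eq_start_or_lt h (Or.inr hx) with rfl | h
  · exact le_rfl
  · exact h.le

theorem le_end (h : IsWalk N.tail N.head u v l) (hx : x ∈ N.pathVerts l) :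
    N.topOrd x ≤ N.topOrd v := by
  rcases eq_end_or_lt h (Or.inr hx) with rfl | h
  · exact le_rfl
  · exact h.le

theorem walk_pairwise (h : IsWalk N.tail N.head u v l) :
    l.Pairwise fun a b => N.topOrd (N.head a) ≤ N.topOrd (N.tail b) := by
  induction l generalizing u with
  | nil => exact List.Pairwise.nil
  | cons a l ih =>
    exact List.pairwise_cons.2
      ⟨fun b hb => start_le h.2 (tail_mem_pathVerts hb), ih h.2⟩

theorem walk_nodup (h : IsWalk N.tail N.head u v l) : l.Nodup :=
  (walk_pairwise h).imp fun {a b} hab hne => by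
    subst hne
    exact (N.topOrd_lt a).not_ge hab

theorem eq_or_le_or_le (h : IsWalk N.tail N.head u v l) {a b : N.A} (ha : a ∈ l) (hb : b ∈ l) :
    a = b ∨ N.topOrd (N.head a) ≤ N.topOrd (N.tail b) ∨
      N.topOrd (N.head b) ≤ N.topOrd (N.tail a) := by
  have : Std.Symm fun a b => N.topOrd (N.head a) ≤ N.topOrd (N.tail b) ∨
      N.topOrd (N.head b) ≤ N.topOrd (N.tail a) := ⟨fun _ _ h => h.symm⟩
  have key : l.Pairwise fun a b => N.topOrd (N.head a) ≤ N.topOrd (N.tail b) ∨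
      N.topOrd (N.head b) ≤ N.topOrd (N.tail a) := (walk_pairwise h).imp Or.inl
  exact or_iff_not_imp_left.2 (key.forall ha hb)

theorem eq_of_tail_eq (h : IsWalk N.tail N.head u v l) {a b : N.A} (ha : a ∈ l) (hb : b ∈ l)
    (hab : N.tail a = N.tail b) : a = b := by
  have h₁ := N.topOrd_lt a
  have h₂ := N.topOrd_lt b
  rcases eq_or_le_or_le h ha hb with h | h | h
  · exact h
  · rw [hab] at h₁
    omega
  · rw [← hab] at h₂
    omega

theorem head_le_of_tail_lt (h : IsWalk N.tail N.head u v l) {b : N.A} (hb : b ∈ l)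
    (hx : x ∈ N.pathVerts l) (hbx : N.topOrd (N.tail b) < N.topOrd x) :
    N.topOrd (N.head b) ≤ N.topOrd x := by
  obtain ⟨c, hc, hx⟩ := hx
  have := N.topOrd_lt c
  rcases eq_or_le_or_le h hb hc with rfl | h | h <;> rcases hx with rfl | rfl <;> omega

theorem exists_split (h : IsWalk N.tail N.head u v l) (hx : x ∈ insert u (N.pathVerts l)) :
    ∃ α β, l = α ++ β ∧ IsWalk N.tail N.head u x α ∧ IsWalk N.tail N.head x v β := by
  induction l generalizing u with
  | nil =>
    obtain rfl : x = u := by simpa [pathVerts] using hx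
    exact ⟨[], [], rfl, rfl, h⟩
  | cons a l ih =>
    by_cases hxu : x = u
    · subst hxu
      exact ⟨[], a :: l, rfl, rfl, h⟩
    · obtain ⟨rfl, h⟩ := h
      rw [insert_pathVerts_cons] at hx
      obtain ⟨α, β, rfl, hα, hβ⟩ := ih h (hx.resolve_left hxu)
      exact ⟨a :: α, β, rfl, ⟨rfl, hα⟩, hβ⟩

theorem exists_next (h : IsWalk N.tail N.head u v l) (hx : x ∈ N.pathVerts l)
    (hxv : x ≠ v) : ∃ b ∈ l, N.tail b = x := by
  obtain ⟨α, β, rfl, -, hβ⟩ := exists_split h (Or.inr hx)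
  cases β with
  | nil => exact absurd hβ hxv
  | cons b β => exact ⟨b, by simp, hβ.1⟩

theorem exists_next_of_lt (h : IsWalk N.tail N.head u v l) (hx : x ∈ N.pathVerts l)
    (hy : y ∈ N.pathVerts l) (hxy : N.topOrd x < N.topOrd y) :
    ∃ b ∈ l, N.tail b = x ∧ N.topOrd (N.head b) ≤ N.topOrd y := by
  obtain ⟨b, hb, rfl⟩ := exists_next h hx (by rintro rfl; exact hxy.not_ge (le_end h hy))
  exact ⟨b, hb, rfl, head_le_of_tail_lt h hb hy hxy⟩

theorem eq_of_topOrd_eq (h : IsWalk N.tail N.head u v l) (hx : x ∈ N.pathVerts l)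
    (hy : y ∈ N.pathVerts l) (hxy : N.topOrd x = N.topOrd y) : x = y := by
  obtain ⟨α, β, rfl, hα, hβ⟩ := exists_split h (Or.inr hx)
  obtain ⟨c, hc, hyc⟩ := hy
  rcases List.mem_append.1 hc with hc | hc
  · rcases eq_end_or_lt hα (Or.inr ⟨c, hc, hyc⟩) with h | h
    · exact h.symm
    · omega
  · rcases eq_start_or_lt hβ (Or.inr ⟨c, hc, hyc⟩) with h | h
    · exact h.symm
    · omega

/-- A walk all of whose arcs lie on another walk with the same start is a prefix of it. -/
theorem isPrefix_of_subset {w : N.V} {m : List N.A} (h : IsWalk N.tail N.head u v l)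
    (h' : IsWalk N.tail N.head u w m) (hlm : l ⊆ m) : l <+: m := by
  induction l generalizing u m with
  | nil => simp
  | cons a l ih =>
    cases m with
    | nil => exact absurd (hlm (List.mem_cons_self (l := l))) (by simp)
    | cons b m =>
      obtain rfl : a = b := eq_of_tail_eq h' (hlm (by simp)) (by simp) (h.1.trans h'.1.symm)
      refine List.cons_prefix_cons.2 ⟨rfl, ih h.2 h'.2 fun c hc => ?_⟩
      refine (List.mem_cons.1 (hlm (List.mem_cons_of_mem _ hc))).resolve_left ?_
      rintro rfl
      exact (List.nodup_cons.1 (walk_nodup h)).1 hc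

end Walk

namespace IsStrongSystem

theorem isWalk (h : N.IsStrongSystem P) (i j : Fin k) :
    IsWalk N.tail N.head (N.src i) (N.snk j) (P i j) := (isPathFrom_iff.1 (h.1 i j)).2

theorem ne_nil (h : N.IsStrongSystem P) (i j : Fin k) : P i j ≠ [] := (h.1 i j).1

theorem src_mem (h : N.IsStrongSystem P) (i j : Fin k) : N.src i ∈ N.pathVerts (P i j) :=
  start_mem_pathVerts (h.isWalk i j) (h.ne_nil i j)

theorem eq_of_mem (h : N.IsStrongSystem P) {i i' j : Fin k} {a : N.A} (ha : a ∈ P i j)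
    (ha' : a ∈ P i' j) : i = i' := by
  by_contra hi
  exact h.2 j i i' hi a ha ha'

theorem snk_notMem (h : N.IsStrongSystem P) {i j j' : Fin k} (hj : j' ≠ j) :
    N.snk j ∉ N.pathVerts (P i j') := fun hm => by
  obtain ⟨b, -, hb⟩ := exists_next (h.isWalk i j') hm fun h => hj (N.snk_inj h).symm
  exact N.snk_no_out j b hb

theorem netOut_eq (h : N.IsStrongSystem P) (j : Fin k) (v : N.V) :
    netOut N.tail N.head (Finset.univ.filter fun a => ∃ i, a ∈ P i j) v =
      ∑ i, ((if N.src i = v then 1 else 0) - if N.snk j = v then 1 else 0) := by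
  have hF : (Finset.univ.filter fun a => ∃ i, a ∈ P i j) =
      Finset.univ.biUnion fun i => (P i j).toFinset := by
    ext a
    simp
  rw [netOut, hF, Finset.sum_biUnion]
  · refine Finset.sum_congr rfl fun i _ => ?_
    rw [List.sum_toFinset _ (walk_nodup (h.isWalk i j)),
      (h.isWalk i j).sum_sub fun x => if x = v then 1 else 0]
  · intro i _ i' _ hi
    simp only [Function.onFun, Finset.disjoint_left, List.mem_toFinset]
    exact fun a ha ha' => hi (h.eq_of_mem ha ha')

end IsStrongSystem

/-- There is a nonempty directed walk from `u` to `v` in the `j`-th residual network. -/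
def ResidReach (N : KPairNetwork k) (P : Fin k → Fin k → List N.A) (j : Fin k) :
    N.V → N.V → Prop :=
  Relation.TransGen fun x y => ∃ a, N.rtail P j a = x ∧ N.rhead P j a = y

theorem residReach_arc {j : Fin k} {a : N.A} (h : ∀ i, a ∉ P i j) :
    N.ResidReach P j (N.tail a) (N.head a) :=
  .single ⟨a, by simp [rtail, h], by simp [rhead, h]⟩

theorem residReach_arc_rev {i j : Fin k} {a : N.A} (h : a ∈ P i j) :
    N.ResidReach P j (N.head a) (N.tail a) :=
  .single ⟨a, by rw [rtail, if_pos ⟨i, h⟩], by rw [rhead, if_pos ⟨i, h⟩]⟩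

namespace IsStableSystem

/-- The residual networks of a stable system are acyclic. -/
theorem not_residReach_self (h : N.IsStableSystem P) (j : Fin k) (v : N.V) :
    ¬ N.ResidReach P j v v := by
  intro hv
  obtain ⟨l, hl, hw⟩ := IsWalk.exists_of_transGen hv
  obtain ⟨u, m, hm, hne, hd⟩ := hw.exists_nodup hl
  set F : Finset N.A := Finset.univ.filter fun a => ∃ i, a ∈ P i j with hF
  have hbal : ∀ v, netOut N.tail N.head (symmDiff F m.toFinset) v = netOut N.tail N.head F v := by
    intro v
    rw [netOut_symmDiff, List.sum_toFinset _ hd, add_eq_left]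
    have := hm.sum_sub fun x => if x = v then 1 else 0
    rw [sub_self] at this
    refine Eq.trans (congrArg List.sum (List.map_congr_left fun a _ => ?_)) this
    by_cases ha : ∃ i, a ∈ P i j <;> simp [rtail, rhead, hF, ha]
  obtain ⟨Q, hQ, hQF, hQd⟩ := exists_disjoint_walks (f := N.tail) (g := N.head) (t := N.snk j)
    N.src Finset.univ (F := symmDiff F m.toFinset) fun v hv => by
      rw [hbal, h.1.netOut_eq]
      simp [hv.symm]
  have hQP : ∀ i, Q i = P i j := by
    refine h.2 j Q (fun i => isPathFrom_iff.2 ⟨fun hQi => ?_, hQ i (by simp)⟩)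
      fun i i' hi a => hQd i (by simp) i' (by simp) hi a
    have hs := hQ i (by simp)
    rw [hQi] at hs
    have hw := h.1.isWalk i j
    cases hPij : P i j with
    | nil => exact h.1.ne_nil i j hPij
    | cons a l =>
      rw [hPij] at hw
      exact N.snk_no_out j a (hw.1.trans hs)
  have hmF : ∀ a ∈ m, ∀ i, a ∉ P i j := by
    intro a ha i hi
    have := hQF i (by simp) a (hQP i ▸ hi)
    rw [Finset.mem_symmDiff] at this
    simp [hF, ha] at this
    exact this i hi
  have key : ∀ (m : List N.A) (x y : N.V), IsWalk (N.rtail P j) (N.rhead P j) x y m →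
      (∀ a ∈ m, ∀ i, a ∉ P i j) → IsWalk N.tail N.head x y m := by
    intro m
    induction m with
    | nil => exact fun x y h _ => h
    | cons a m ih =>
      intro x y h hm
      have ha := hm a (by simp)
      refine ⟨by simpa [rtail, ha] using h.1, ih _ _ ?_ fun b hb => hm b (by simp [hb])⟩
      simpa [rhead, ha] using h.2
  have hwalk := key m u u hm hmF
  cases m with
  | nil => exact hne rfl
  | cons a m =>
    have h₁ := le_end hwalk (head_mem_pathVerts (a := a) (by simp))
    rw [← hwalk.1] at h₁
    exact (N.topOrd_lt a).not_ge h₁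

end IsStableSystem
end KPairNetwork

namespace KPairNetwork

variable {k : ℕ} {N : KPairNetwork k} {P : Fin k → Fin k → List N.A}

theorem ResidReach.trans {j : Fin k} {u v w : N.V} (h : N.ResidReach P j u v)
    (h' : N.ResidReach P j v w) : N.ResidReach P j u w := Relation.TransGen.trans h h'

/-- A stretch of a walk without arcs of the paths towards the `j`-th sink survives in the `j`-th
residual network. -/
theorem residReach_of_walk {j : Fin k} {s t u w : N.V} {q : List N.A}
    (hq : IsWalk N.tail N.head s t q) (hu : u ∈ N.pathVerts q) (hw : w ∈ N.pathVerts q)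
    (huw : N.topOrd u < N.topOrd w)
    (h : ∀ b ∈ q, N.topOrd u ≤ N.topOrd (N.tail b) → N.topOrd (N.head b) ≤ N.topOrd w →
      ∀ i, b ∉ P i j) : N.ResidReach P j u w := by
  induction hn : N.topOrd w - N.topOrd u using Nat.strong_induction_on generalizing u with
  | _ n ih =>
    obtain ⟨b, hb, rfl, hbw⟩ := exists_next_of_lt hq hu hw huw
    have hlt := N.topOrd_lt b
    have hR := residReach_arc (h b hb le_rfl hbw)
    rcases hbw.eq_or_lt with heq | hbw
    · rwa [eq_of_topOrd_eq hq (head_mem_pathVerts hb) hw heq] at hR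
    · exact hR.trans (ih _ (by omega) (head_mem_pathVerts hb) hbw
        (fun c hc hc' => h c hc (hlt.le.trans hc')) rfl)

namespace IsStrongSystem

theorem residReach_rev (hP : N.IsStrongSystem P) {i j : Fin k} {u w : N.V}
    (hu : u ∈ N.pathVerts (P i j)) (hw : w ∈ N.pathVerts (P i j))
    (huw : N.topOrd u < N.topOrd w) : N.ResidReach P j w u := by
  induction hn : N.topOrd w - N.topOrd u using Nat.strong_induction_on generalizing u with
  | _ n ih =>
    obtain ⟨b, hb, rfl, hbw⟩ := exists_next_of_lt (hP.isWalk i j) hu hw huw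
    have hlt := N.topOrd_lt b
    have hR := residReach_arc_rev hb
    rcases hbw.eq_or_lt with heq | hbw
    · rwa [eq_of_topOrd_eq (hP.isWalk i j) (head_mem_pathVerts hb) hw heq] at hR
    · exact (ih _ (by omega) (head_mem_pathVerts hb) hbw rfl).trans hR

theorem residReach_of_lt (hP : N.IsStrongSystem P) {n j j' : Fin k} {u w : N.V}
    (hu : u ∈ N.pathVerts (P n j')) (hw : w ∈ N.pathVerts (P n j'))
    (huw : N.topOrd u < N.topOrd w)
    (hbetween : ∀ x ∈ N.pathVerts (P n j'), N.topOrd u < N.topOrd x → N.topOrd x < N.topOrd w →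
      ∀ i, x ∉ N.pathVerts (P i j))
    (hends : ∀ i, u ∈ N.pathVerts (P i j) → w ∉ N.pathVerts (P i j)) : N.ResidReach P j u w := by
  have hq := hP.isWalk n j'
  refine residReach_of_walk hq hu hw huw fun b hb hub hbw i hbi => ?_
  have hlt := N.topOrd_lt b
  have htail : N.topOrd u = N.topOrd (N.tail b) := hub.antisymm <| not_lt.1 fun h =>
    hbetween _ (tail_mem_pathVerts hb) h (by omega) i (tail_mem_pathVerts hbi)
  have hhead : N.topOrd (N.head b) = N.topOrd w := hbw.antisymm <| not_lt.1 fun h =>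
    hbetween _ (head_mem_pathVerts hb) (by omega) h i (head_mem_pathVerts hbi)
  refine hends i ?_ ?_
  · rw [eq_of_topOrd_eq hq hu (tail_mem_pathVerts hb) htail]
    exact tail_mem_pathVerts hbi
  · rw [← eq_of_topOrd_eq hq (head_mem_pathVerts hb) hw hhead]
    exact head_mem_pathVerts hbi

end IsStrongSystem

namespace IsStableSystem

/-- Distinct paths towards the same sink only meet in vertices that lie on no path towards another
sink. -/
theorem eq_of_mem_pathVerts (hP : N.IsStableSystem P) {i i' j n j' : Fin k} {v : N.V}
    (hj : j' ≠ j) (hn : v ∈ N.pathVerts (P n j')) (hv : v ∈ N.pathVerts (P i j))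
    (hv' : v ∈ N.pathVerts (P i' j)) : i = i' := by
  by_contra hi
  have hvt : v ≠ N.snk j := by
    rintro rfl
    exact hP.1.snk_notMem hj hn
  obtain ⟨α, β, hαβ, hα, hβ⟩ := exists_split (hP.1.isWalk i j) (Or.inr hv)
  obtain ⟨α', β', hαβ', hα', hβ'⟩ := exists_split (hP.1.isWalk i' j) (Or.inr hv')
  have hβne : β ≠ [] := by
    rintro rfl
    exact hvt hβ
  have hβne' : β' ≠ [] := by
    rintro rfl
    exact hvt hβ'
  have hd : ∀ a, a ∈ P i j → a ∉ P i' j := hP.1.2 j i i' hi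
  let Q : Fin k → List N.A := fun m => if m = i then α ++ β' else if m = i' then α' ++ β else P m j
  have hQi : Q i = α ++ β' := if_pos rfl
  have hQi' : Q i' = α' ++ β := by simp [Q, Ne.symm hi]
  have hQm : ∀ m, m ≠ i → m ≠ i' → Q m = P m j := fun m h h' => by simp [Q, h, h']
  have hsub : ∀ m, ∀ a ∈ Q m, a ∈ P m j ∨ (m = i ∧ a ∈ β') ∨ (m = i' ∧ a ∈ β) := by
    grind
  have hQ : ∀ m, Q m = P m j := by
    refine hP.2 j Q (fun m => isPathFrom_iff.2 ?_) ?_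
    · by_cases hm : m = i
      · subst hm
        rw [hQi]
        exact ⟨by simp [hβne'], IsWalk.append_iff.2 ⟨v, hα, hβ'⟩⟩
      · by_cases hm' : m = i'
        · subst hm'
          rw [hQi']
          exact ⟨by simp [hβne], IsWalk.append_iff.2 ⟨v, hα', hβ⟩⟩
        · rw [hQm m hm hm']
          exact isPathFrom_iff.1 (hP.1.1 m j)
    · have hnd := walk_nodup (hP.1.isWalk i j)
      have hnd' := walk_nodup (hP.1.isWalk i' j)
      rw [hαβ, List.nodup_append] at hnd
      rw [hαβ', List.nodup_append] at hnd'
      have hdis := hP.1.2 j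
      intro m m' hmm a ha ha'
      grind
  obtain ⟨b, hb⟩ := List.exists_mem_of_ne_nil β' hβne'
  exact hd b (hQ i ▸ hQi ▸ List.mem_append_right _ hb) (hαβ' ▸ List.mem_append_right _ hb)

theorem residReach_false (hP : N.IsStableSystem P) {i j : Fin k} {u w : N.V}
    (hu : u ∈ N.pathVerts (P i j)) (hw : w ∈ N.pathVerts (P i j))
    (huw : N.topOrd u < N.topOrd w) (hR : N.ResidReach P j u w) : False :=
  hP.not_residReach_self j u (hR.trans (hP.1.residReach_rev hu hw huw))

/-- A path towards another sink that leaves `P i j` and comes back to it without meeting other paths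
towards the `j`-th sink does not leave it at all. -/
theorem mem_of_between (hP : N.IsStableSystem P) {n i j j' : Fin k} {u w : N.V}
    (hu : u ∈ N.pathVerts (P n j')) (hui : u ∈ N.pathVerts (P i j))
    (hw : w ∈ N.pathVerts (P n j')) (hwi : w ∈ N.pathVerts (P i j))
    (honly : ∀ x ∈ N.pathVerts (P n j'), N.topOrd u < N.topOrd x → N.topOrd x < N.topOrd w →
      ∀ m, x ∈ N.pathVerts (P m j) → m = i) {x : N.V} (hx : x ∈ N.pathVerts (P n j'))
    (hux : N.topOrd u ≤ N.topOrd x) (hxw : N.topOrd x ≤ N.topOrd w) :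
    x ∈ N.pathVerts (P i j) := by
  by_contra hxi
  have hq := hP.1.isWalk n j'
  obtain ⟨y, ⟨hy, hyi, hyx⟩, hymax⟩ := Set.exists_max_image
    {y | y ∈ N.pathVerts (P n j') ∧ y ∈ N.pathVerts (P i j) ∧ N.topOrd y ≤ N.topOrd x}
    N.topOrd (Set.toFinite _) ⟨u, hu, hui, hux⟩
  obtain ⟨z, ⟨hz, hzi, hxz⟩, hzmin⟩ := Set.exists_min_image
    {y | y ∈ N.pathVerts (P n j') ∧ y ∈ N.pathVerts (P i j) ∧ N.topOrd x ≤ N.topOrd y}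
    N.topOrd (Set.toFinite _) ⟨w, hw, hwi, hxw⟩
  have hyx' : N.topOrd y < N.topOrd x := hyx.lt_of_ne fun h =>
    hxi (eq_of_topOrd_eq hq hy hx h ▸ hyi)
  have hxz' : N.topOrd x < N.topOrd z := hxz.lt_of_ne fun h =>
    hxi (eq_of_topOrd_eq hq hx hz h ▸ hzi)
  have huy := hymax u ⟨hu, hui, hux⟩
  have hzw := hzmin w ⟨hw, hwi, hxw⟩
  have hnot : ∀ c ∈ N.pathVerts (P n j'), N.topOrd y < N.topOrd c → N.topOrd c < N.topOrd z →
      ∀ m, c ∉ N.pathVerts (P m j) := by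
    intro c hc hyc hcz m hm
    obtain rfl := honly c hc (by omega) (by omega) m hm
    rcases le_total (N.topOrd c) (N.topOrd x) with h | h
    · have := hymax c ⟨hc, hm, h⟩
      omega
    · have := hzmin c ⟨hc, hm, h⟩
      omega
  refine hP.residReach_false hyi hzi (hyx'.trans hxz') <|
    residReach_of_walk hq hy hz (hyx'.trans hxz') fun b hb hyb hbz m hbm => ?_
  rcases hyb.eq_or_lt with h | h
  · have hle := head_le_of_tail_lt hq hb hx (by omega)
    exact hnot _ (head_mem_pathVerts hb) (by have := N.topOrd_lt b; omega) (by omega) m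
      (head_mem_pathVerts hbm)
  · exact hnot _ (tail_mem_pathVerts hb) h (by have := N.topOrd_lt b; omega) m
      (tail_mem_pathVerts hbm)

theorem mem_iff_mem (hP : N.IsStableSystem P) {n i j j' : Fin k} {u w : N.V} (hj : j' ≠ j)
    (hu : u ∈ N.pathVerts (P n j')) (hui : u ∈ N.pathVerts (P i j))
    (hw : w ∈ N.pathVerts (P n j')) (hwi : w ∈ N.pathVerts (P i j))
    (honly : ∀ x ∈ N.pathVerts (P n j'), N.topOrd u < N.topOrd x → N.topOrd x < N.topOrd w →
      ∀ m, x ∈ N.pathVerts (P m j) → m = i) (x : N.V)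
    (hux : N.topOrd u ≤ N.topOrd x) (hxw : N.topOrd x ≤ N.topOrd w) :
    x ∈ N.pathVerts (P n j') ↔ x ∈ N.pathVerts (P i j) := by
  have hq := hP.1.isWalk n j'
  have hp := hP.1.isWalk i j
  refine ⟨fun hx => hP.mem_of_between hu hui hw hwi honly hx hux hxw, fun hxi => ?_⟩
  obtain ⟨y, ⟨hy, huy, hyx⟩, hymax⟩ := Set.exists_max_image
    {y | y ∈ N.pathVerts (P n j') ∧ N.topOrd u ≤ N.topOrd y ∧ N.topOrd y ≤ N.topOrd x}
    N.topOrd (Set.toFinite _) ⟨u, hu, le_rfl, hux⟩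
  have hyi := hP.mem_of_between hu hui hw hwi honly hy huy (hyx.trans hxw)
  rcases hyx.eq_or_lt with h | hyx
  · rwa [← eq_of_topOrd_eq hp hyi hxi h]
  obtain ⟨b, hb, rfl, hbw⟩ := exists_next_of_lt hq hy hw (by omega)
  have hlt := N.topOrd_lt b
  have hbi := hP.mem_of_between hu hui hw hwi honly (head_mem_pathVerts hb) (by omega) hbw
  have hxb : N.topOrd x < N.topOrd (N.head b) := not_le.1 fun h => by
    have := hymax _ ⟨head_mem_pathVerts hb, by omega, h⟩
    omega
  by_cases hbP : ∃ m, b ∈ P m j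
  · obtain ⟨m, hm⟩ := hbP
    obtain rfl := hP.eq_of_mem_pathVerts hj hy (tail_mem_pathVerts hm) hyi
    exact absurd (head_le_of_tail_lt hp hm hxi hyx) hxb.not_ge
  · exact (hP.residReach_false hyi hbi hlt (residReach_arc (not_exists.1 hbP))).elim

end IsStableSystem

end KPairNetwork

namespace KPairNetwork

variable {k : ℕ} {N : KPairNetwork k} {P : Fin k → Fin k → List N.A} {s s' : N.V × List N.A}

theorem IsSeg.exists_isWalk (h : N.IsSeg s) : ∃ v, IsWalk N.tail N.head s.1 v s.2 := by
  by_cases hs : s.2 = []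
  · exact ⟨s.1, by rw [hs]; rfl⟩
  · exact ⟨N.head (s.2.getLast hs), (IsWalk.iff_isChain hs).2 ⟨h.1, h.2, fun a ha => by
      rw [List.getLast?_eq_getLast_of_ne_nil hs, Option.mem_some_iff] at ha
      rw [ha]⟩⟩

theorem isSeg_of_isWalk {u v : N.V} {l : List N.A} (h : IsWalk N.tail N.head u v l) :
    N.IsSeg (u, l) := by
  by_cases hl : l = []
  · subst hl
    exact ⟨List.IsChain.nil, by simp⟩
  · have := (IsWalk.iff_isChain hl).1 h
    exact ⟨this.1, this.2.1⟩

theorem SegOn.segVerts_subset {p : List N.A} (h : N.SegOn s p) : N.segVerts s ⊆ N.pathVerts p :=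
  Set.insert_subset h.2 (pathVerts_mono h.1.subset)

theorem SegLE.segVerts_subset (h : N.SegLE s s') : N.segVerts s ⊆ N.segVerts s' :=
  Set.insert_subset h.2 ((pathVerts_mono h.1.subset).trans (Set.subset_insert _ _))

theorem SegLE.eq_of_length_le (h : N.SegLE s s') (hs : N.IsSeg s) (hs' : N.IsSeg s')
    (hl : s'.2.length ≤ s.2.length) : s = s' := by
  obtain ⟨x, l⟩ := s
  obtain ⟨y, m⟩ := s'
  obtain rfl : l = m := h.1.eq_of_length_le hl
  cases l with
  | nil =>
    have := h.2
    simp only [segVerts, pathVerts] at this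
    simpa using this
  | cons a l =>
    obtain rfl : N.tail a = x := hs.2 a rfl
    obtain rfl : N.tail a = y := hs'.2 a rfl
    rfl

theorem exists_isLCS_of_segOn {p q : List N.A} {v : N.V} (hs : N.IsSeg s) (hp : N.SegOn s p)
    (hq : N.SegOn s q) (hv : v ∈ N.segVerts s) :
    ∃ s, N.IsLCS {p, q} s ∧ v ∈ N.segVerts s := by
  induction hn : p.length - s.2.length using Nat.strong_induction_on generalizing s with
  | _ n ih =>
    by_cases hmax : ∃ s', N.IsSeg s' ∧ N.SegLE s s' ∧ s' ≠ s ∧ N.SegOn s' p ∧ N.SegOn s' q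
    · obtain ⟨s', hs', hle, hne, hp', hq'⟩ := hmax
      have hlt : s.2.length < s'.2.length := not_le.1 fun h =>
        hne (hle.eq_of_length_le hs hs' h).symm
      have := hp'.1.length_le
      exact ih _ (by omega) hs' hp' hq' (hle.segVerts_subset hv) rfl
    · refine ⟨s, ⟨hs, by simp [hp, hq], fun s' hs' hle hne => ?_⟩, hv⟩
      by_contra! h
      exact hmax ⟨s', hs', hle, hne, h p (by simp), h q (by simp)⟩

/-- Every common vertex of two paths lies on a longest common segment of them. -/
theorem exists_isLCS {p q : List N.A} {v : N.V} (hp : v ∈ N.pathVerts p)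
    (hq : v ∈ N.pathVerts q) : ∃ s, N.IsLCS {p, q} s ∧ v ∈ N.segVerts s :=
  exists_isLCS_of_segOn (s := (v, [])) (isSeg_of_isWalk (v := v) rfl)
    ⟨by simp, hp⟩ ⟨by simp, hq⟩ (Set.mem_insert _ _)

theorem lcsCount_comm (j₁ j₂ : Fin k) (p : List N.A) :
    N.lcsCount P j₁ j₂ p = N.lcsCount P j₂ j₁ p := by
  have : ∀ s, N.IsPairLCSOn P j₁ j₂ p s ↔ N.IsPairLCSOn P j₂ j₁ p s := fun s =>
    and_congr_left' ⟨fun ⟨i, i', h⟩ => ⟨i', i, Set.pair_comm _ _ ▸ h⟩,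
      fun ⟨i, i', h⟩ => ⟨i', i, Set.pair_comm _ _ ▸ h⟩⟩
  simp only [lcsCount, this]

namespace IsStableSystem

/-- If `P z j` carries a single longest common segment with the paths towards another sink `j'`,
then it only meets `P z j'` among these, in an initial segment. -/
theorem initial_of_lcsCount_eq_one (hP : N.IsStableSystem P) {z i j j' : Fin k} (hj : j' ≠ j)
    (hc : N.lcsCount P j j' (P z j) = 1) {v : N.V} (hv : v ∈ N.pathVerts (P z j))
    (hv' : v ∈ N.pathVerts (P i j')) :
    i = z ∧ ∀ u ∈ N.pathVerts (P z j'), N.topOrd u ≤ N.topOrd v → u ∈ N.pathVerts (P z j) := by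
  obtain ⟨s₀, hs₀, hz⟩ := exists_isLCS (hP.1.src_mem z j) (hP.1.src_mem z j')
  obtain ⟨s, hs, hvs⟩ := exists_isLCS hv hv'
  have hsub := (Nat.card_eq_one_iff_unique.1 hc).1
  have heq : s₀ = s := congrArg Subtype.val <| hsub.elim
    ⟨s₀, ⟨z, z, hs₀⟩, hs₀.2.1 _ (by simp)⟩ ⟨s, ⟨z, i, hs⟩, hs.2.1 _ (by simp)⟩
  subst heq
  have hi : i = z := hP.eq_of_mem_pathVerts hj.symm (hP.1.src_mem z j)
    ((hs.2.1 (P i j') (by simp)).segVerts_subset hz) (hP.1.src_mem z j')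
  subst hi
  refine ⟨rfl, fun u hu huv => ?_⟩
  obtain ⟨y, ⟨hy, hyu⟩, hymax⟩ := Set.exists_max_image
    {y | y ∈ N.segVerts s₀ ∧ N.topOrd y ≤ N.topOrd u} N.topOrd (Set.toFinite _)
    ⟨N.src i, hz, start_le (hP.1.isWalk i j') hu⟩
  have hq := hP.1.isWalk i j'
  have hsub' := (hs.2.1 (P i j') (by simp)).segVerts_subset
  have hyi : y ∈ N.pathVerts (P i j) := (hs.2.1 (P i j) (by simp)).segVerts_subset hy
  rcases hyu.eq_or_lt with h | h
  · rwa [← eq_of_topOrd_eq hq (hsub' hy) hu h]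
  obtain ⟨e, he⟩ := hs.1.exists_isWalk
  by_cases hnil : s₀.2 = []
  · simp only [segVerts, hnil, pathVerts] at hy hvs
    obtain rfl : y = s₀.1 := by simpa using hy
    obtain rfl : v = s₀.1 := by simpa using hvs
    omega
  · have hins : N.segVerts s₀ = N.pathVerts s₀.2 :=
      Set.insert_eq_of_mem (start_mem_pathVerts he hnil)
    rw [hins] at hy hvs hymax
    obtain ⟨b, hb, rfl, -⟩ := exists_next_of_lt he hy hvs (by omega)
    have hbq : b ∈ P i j' := (hs.2.1 (P i j') (by simp)).1.subset hb
    have := hymax _ ⟨head_mem_pathVerts hb, head_le_of_tail_lt hq hbq hu h⟩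
    have := N.topOrd_lt b
    omega

/-- If `P z j'` only meets `P z j` among the paths towards the `j`-th sink, then it carries a single
longest common segment with these. -/
theorem lcsCount_eq_one (hP : N.IsStableSystem P) {z j j' : Fin k} (hj : j' ≠ j)
    (h : ∀ i, ∀ v ∈ N.pathVerts (P z j'), v ∈ N.pathVerts (P i j) → i = z) :
    N.lcsCount P j' j (P z j') = 1 := by
  have hq := hP.1.isWalk z j'
  have hp := hP.1.isWalk z j
  have hzq := hP.1.src_mem z j'
  have hzp := hP.1.src_mem z j
  obtain ⟨v, ⟨hvq, hvp⟩, hvmax⟩ := Set.exists_max_image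
    {v | v ∈ N.pathVerts (P z j') ∧ v ∈ N.pathVerts (P z j)} N.topOrd (Set.toFinite _)
    ⟨N.src z, hzq, hzp⟩
  obtain ⟨α, β, hαβ, hα, hβ⟩ := exists_split hq (Or.inr hvq)
  have hsubq : α ⊆ P z j' := hαβ ▸ List.subset_append_left α β
  have hmem : ∀ x ∈ N.pathVerts α, x ∈ N.pathVerts (P z j) := fun x hx =>
    hP.mem_of_between hzq hzp hvq hvp (fun y hy _ _ m hm => h m y hy hm)
      (pathVerts_mono hsubq hx) (start_le hα hx) (le_end hα hx)
  have hsubp : α ⊆ P z j := by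
    intro b hb
    by_cases hbP : ∃ m, b ∈ P m j
    · obtain ⟨m, hm⟩ := hbP
      obtain rfl := h m _ (tail_mem_pathVerts (hsubq hb)) (tail_mem_pathVerts hm)
      exact hm
    · exact (hP.residReach_false (hmem _ (tail_mem_pathVerts hb)) (hmem _ (head_mem_pathVerts hb))
        (N.topOrd_lt b) (residReach_arc (not_exists.1 hbP))).elim
  have hseg : N.IsSeg (N.src z, α) := isSeg_of_isWalk hα
  have hon : ∀ p ∈ ({P z j', P z j} : Set (List N.A)), N.SegOn (N.src z, α) p := by
    rintro p (rfl | rfl)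
    · exact ⟨hαβ ▸ (List.prefix_append α β).isInfix, hzq⟩
    · exact ⟨(isPrefix_of_subset hα hp hsubp).isInfix, hzp⟩
  have hfilter : (P z j').filter (fun a => N.topOrd (N.head a) ≤ N.topOrd v) = α := by
    rw [hαβ, List.filter_append, List.filter_eq_self.2, List.filter_eq_nil_iff.2,
      List.append_nil]
    · intro a ha
      have := start_le hβ (tail_mem_pathVerts ha)
      have := N.topOrd_lt a
      simpa using by omega
    · intro a ha
      simpa using le_end hα (head_mem_pathVerts ha)
  have huniq : ∀ s, N.IsLCS {P z j', P z j} s → s = (N.src z, α) := by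
    intro s hs
    have hsq := hs.2.1 (P z j') (by simp)
    have hsp := hs.2.1 (P z j) (by simp)
    have hle : ∀ x ∈ N.segVerts s, N.topOrd x ≤ N.topOrd v := fun x hx =>
      hvmax x ⟨hsq.segVerts_subset hx, hsp.segVerts_subset hx⟩
    have hinf : s.2 <:+: α := by
      have := hsq.1.filter (fun a => decide (N.topOrd (N.head a) ≤ N.topOrd v))
      rwa [hfilter, List.filter_eq_self.2 fun a ha => by
        simpa using hle _ (Or.inr (head_mem_pathVerts ha))] at this
    have hstart : s.1 ∈ N.segVerts (N.src z, α) := by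
      obtain ⟨c, hc, hx⟩ := hsq.2
      rw [hαβ] at hc
      rcases List.mem_append.1 hc with hc | hc
      · exact Or.inr ⟨c, hc, hx⟩
      · rw [eq_of_topOrd_eq hq hsq.2 hvq ((hle _ (Or.inl rfl)).antisymm (start_le hβ ⟨c, hc, hx⟩))]
        exact end_mem_insert_pathVerts hα
    by_contra hne
    obtain ⟨p, hp, hn⟩ := hs.2.2 _ hseg ⟨hinf, hstart⟩ (Ne.symm hne)
    exact hn (hon p hp)
  obtain ⟨s₀, hs₀, -⟩ := exists_isLCS hzq hzp
  have hset : {s | N.IsPairLCSOn P j' j (P z j') s} = {(N.src z, α)} := by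
    refine Set.eq_singleton_iff_unique_mem.2
      ⟨huniq s₀ hs₀ ▸ ⟨⟨z, z, hs₀⟩, hs₀.2.1 _ (by simp)⟩, ?_⟩
    rintro s ⟨⟨i, i', hs⟩, hsz⟩
    have hsi := (hs.2.1 (P i j') (by simp)).2
    have hsi' := (hs.2.1 (P i' j) (by simp)).2
    obtain rfl := h i' _ hsz.2 hsi'
    obtain rfl := hP.eq_of_mem_pathVerts hj.symm hsi' hsi hsz.2
    exact huniq s hs
  rw [lcsCount, hset, Nat.card_coe_set_eq, Set.ncard_singleton]

end IsStableSystem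

end KPairNetwork

namespace KPairNetwork.IsStableSystem

variable {N : KPairNetwork 3} {P : Fin 3 → Fin 3 → List N.A}

/-- A stable system whose paths `P (j + 2) j` carry a single longest common segment with the paths
towards each other sink, while the paths `P (j + 1) (j + 1)` carry several with the paths towards
the `j`-th sink, yields a residual configuration. -/
noncomputable def residualConfig (hP : N.IsStableSystem P)
    (hone : ∀ j j', j' ≠ j → N.lcsCount P j j' (P (j + 2) j) = 1)
    (hne : ∀ j, N.lcsCount P (j + 1) j (P (j + 1) (j + 1)) ≠ 1) : ResidualConfig N.V where
  ord := N.topOrd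
  W i j := N.pathVerts (P i j)
  R := N.ResidReach P
  trans := ResidReach.trans
  irrefl := hP.not_residReach_self _ _
  inj := eq_of_topOrd_eq (hP.1.isWalk _ _)
  rev := hP.1.residReach_rev
  disj := hP.eq_of_mem_pathVerts
  step := hP.1.residReach_of_lt
  agree := hP.mem_iff_mem
  start := N.src
  start_mem := hP.1.src_mem
  start_le := start_le (hP.1.isWalk _ _)
  initial hj := hP.initial_of_lcsCount_eq_one hj (hone _ _ hj)
  meet j := by
    by_contra! h
    have hj : j + 1 ≠ j := by grind
    refine hne j (hP.lcsCount_eq_one hj fun i v hv hv' => ?_)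
    by_contra hi
    obtain rfl | rfl : i = j ∨ i = j + 2 := by grind
    · exact h v hv hv'
    · exact hi (hP.initial_of_lcsCount_eq_one hj (hone _ _ hj) hv' hv).1.symm

end KPairNetwork.IsStableSystem

/-- Case 2.4 of the proof of the main theorem: in a stable
3-pair network with `m_{1,2}^1 = {3}`, `m_{1,2}^2 = {1}`, `m_{1,3}^1 = {3}`,
`m_{1,3}^3 = {2}`, `m_{2,3}^2 = {1}`, `m_{2,3}^3 = {2}`, every `s ∈ S_N` with
`α(s) = 3` contains a diagonal element; equivalently, no arc is traversed by
three paths `P_{s_{l₁},t_1}`, `P_{s_{l₂},t_2}`, `P_{s_{l₃},t_3}` with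
`l₁ ≠ 1`, `l₂ ≠ 2`, `l₃ ≠ 3`.  (Indices are 0-based: `t_1, t_2, t_3`
correspond to `0, 1, 2`.) -/
theorem statement15 (N : KPairNetwork 3) (P : Fin 3 → Fin 3 → List N.A)
    (hP : N.IsStableSystem P)
    (h12_1 : N.mset P 0 1 0 = {2}) (h12_2 : N.mset P 0 1 1 = {0})
    (h13_1 : N.mset P 0 2 0 = {2}) (h13_3 : N.mset P 0 2 2 = {1})
    (h23_2 : N.mset P 1 2 1 = {0}) (h23_3 : N.mset P 1 2 2 = {1}) :
    (∀ T ∈ N.SN P, T.card = 3 → ∃ m : Fin 3, (m, m) ∈ T) ∧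
    ∀ (a : N.A) (l₁ l₂ l₃ : Fin 3),
      a ∈ P l₁ 0 → a ∈ P l₂ 1 → a ∈ P l₃ 2 →
      l₁ = 0 ∨ l₂ = 1 ∨ l₃ = 2 := by
  have mem : ∀ {j₁ j₂ c i i' : Fin 3}, N.mset P j₁ j₂ c = {i'} →
      (N.lcsCount P j₁ j₂ (P i c) = 1 ↔ i = i') := fun h => Set.ext_iff.1 h _
  have hone : ∀ j j' : Fin 3, j' ≠ j → N.lcsCount P j j' (P (j + 2) j) = 1 := by
    intro j j' hj
    fin_cases j <;> fin_cases j'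
    · exact absurd rfl hj
    · exact (mem h12_1).2 rfl
    · exact (mem h13_1).2 rfl
    · exact (KPairNetwork.lcsCount_comm _ _ _).trans ((mem h12_2).2 rfl)
    · exact absurd rfl hj
    · exact (mem h23_2).2 rfl
    · exact (KPairNetwork.lcsCount_comm _ _ _).trans ((mem h13_3).2 rfl)
    · exact (KPairNetwork.lcsCount_comm _ _ _).trans ((mem h23_3).2 rfl)
    · exact absurd rfl hj
  have hne : ∀ j : Fin 3, N.lcsCount P (j + 1) j (P (j + 1) (j + 1)) ≠ 1 := by
    intro j
    fin_cases j
    · exact (KPairNetwork.lcsCount_comm _ _ _).trans_ne (mt (mem h12_2).1 (by decide))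
    · exact (KPairNetwork.lcsCount_comm _ _ _).trans_ne (mt (mem h23_3).1 (by decide))
    · exact mt (mem h13_1).1 (by decide)
  have main : ∀ (a : N.A) (l₁ l₂ l₃ : Fin 3), a ∈ P l₁ 0 → a ∈ P l₂ 1 → a ∈ P l₃ 2 →
      l₁ = 0 ∨ l₂ = 1 ∨ l₃ = 2 := by
    intro a l₁ l₂ l₃ h₁ h₂ h₃
    have v₁ := KPairNetwork.tail_mem_pathVerts h₁
    have v₂ := KPairNetwork.tail_mem_pathVerts h₂
    have v₃ := KPairNetwork.tail_mem_pathVerts h₃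
    have hinit : ∀ {i j j' : Fin 3}, j' ≠ j → N.tail a ∈ N.pathVerts (P (j + 2) j) →
        N.tail a ∈ N.pathVerts (P i j') → i = j + 2 := fun hj h h' =>
      (hP.initial_of_lcsCount_eq_one hj (hone _ _ hj) h h').1
    by_contra! hl
    obtain ⟨hl₁, hl₂, hl₃⟩ := hl
    by_cases h : l₁ = 1 ∧ l₂ = 2 ∧ l₃ = 0
    · obtain ⟨rfl, rfl, rfl⟩ := h
      exact (hP.residualConfig hone hne).not_mem_all v₁ v₂ v₃
    · obtain rfl | rfl | rfl : l₁ = 2 ∨ l₂ = 0 ∨ l₃ = 1 := by grind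
      · exact hl₃ (hinit (j := 0) (by decide) v₁ v₃)
      · exact hl₁ (hinit (j := 1) (by decide) v₂ v₁)
      · exact hl₂ (hinit (j := 2) (by decide) v₃ v₂)
  refine ⟨?_, main⟩
  rintro T ⟨a, rfl⟩ hT
  have hmem : ∀ q, q ∈ N.arcPattern P a ↔ a ∈ P q.1 q.2 := fun q => by simp [KPairNetwork.arcPattern]
  have himage : (N.arcPattern P a).image Prod.snd = Finset.univ := by
    refine Finset.eq_univ_of_card _ ?_
    rw [Finset.card_image_of_injOn, hT, Fintype.card_fin]
    intro q h q' h' hq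
    have h₂ := (hmem q').1 h'
    rw [← hq] at h₂
    exact Prod.ext (hP.1.eq_of_mem ((hmem q).1 h) h₂) hq
  have hex : ∀ j, ∃ i, a ∈ P i j := by
    intro j
    obtain ⟨⟨i, _⟩, h, rfl⟩ := Finset.mem_image.1 (himage ▸ Finset.mem_univ j)
    exact ⟨i, (hmem _).1 h⟩
  obtain ⟨l₁, h₁⟩ := hex 0
  obtain ⟨l₂, h₂⟩ := hex 1
  obtain ⟨l₃, h₃⟩ := hex 2
  obtain rfl | rfl | rfl := main a l₁ l₂ l₃ h₁ h₂ h₃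
  · exact ⟨0, (hmem _).2 h₁⟩
  · exact ⟨1, (hmem _).2 h₂⟩
  · exact ⟨2, (hmem _).2 h₃⟩
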